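/- arXiv:2307.01143 — 2 statements merged into one kernel-verified Lean document; each statement's English description precedes it below -/
import Mathlib

section
/- Every second countable compact T1 topological space is homeomorphic to the spectrum SP of some predetermined branching graded ω-poset P. -/
/-- `A` refines `B`: every element of `A` lies below some element of `B`. -/
def Refines {α : Type*} [PartialOrder α] (A B : Set α) : Prop :=
  ∀ a ∈ A, ∃ b ∈ B, a ≤ b

/-- A band: a finite subset such that every element of the poset is comparable with some member. -/
def IsBand {α : Type*} [PartialOrder α] (B : Set α) : Prop :=
  B.Finite ∧ ∀ p : α, ∃ b ∈ B, p ≤ b ∨ b ≤ p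

/-- A cap: a subset refined by some band. -/
def IsCap {α : Type*} [PartialOrder α] (C : Set α) : Prop :=
  ∃ B : Set α, IsBand B ∧ Refines B C

/-- A minimal cap: a cap no proper subset of which is a cap. -/
def IsMinimalCap {α : Type*} [PartialOrder α] (C : Set α) : Prop :=
  IsCap C ∧ ∀ D : Set α, D ⊂ C → ¬ IsCap D

/-- A selector: a subset meeting every cap. -/
def IsSelector {α : Type*} [PartialOrder α] (S : Set α) : Prop :=
  ∀ C : Set α, IsCap C → (S ∩ C).Nonempty

/-- A minimal selector: a selector minimal under inclusion among selectors. -/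
def IsMinSelector {α : Type*} [PartialOrder α] (S : Set α) : Prop :=
  IsSelector S ∧ ∀ T : Set α, T ⊆ S → IsSelector T → T = S

/-- An ω-poset: every principal filter is finite, and for each `n` only finitely many
principal filters have exactly `n` elements. -/
def IsOmegaPoset (α : Type*) [PartialOrder α] : Prop :=
  (∀ p : α, (Set.Ici p).Finite) ∧ ∀ n : ℕ, {p : α | (Set.Ici p).ncard = n}.Finite

/-- The rank of `p`: the length of the longest strictly increasing chain starting at `p`,
i.e. `r(p) = sup_{q > p} (r(q) + 1)`. -/
noncomputable def chainRank {α : Type*} [PartialOrder α] (p : α) : ℕ :=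
  sSup {n : ℕ | ∃ c : ℕ → α, c 0 = p ∧ ∀ i < n, c i < c (i + 1)}

/-- The `n`-th level: the minimal elements of the `n`-th cone `{p | chainRank p ≤ n}`. -/
def levelSet (α : Type*) [PartialOrder α] (n : ℕ) : Set α :=
  {p : α | chainRank p ≤ n ∧ ∀ q : α, q < p → ¬ chainRank q ≤ n}

/-- Predetermined: every non-minimal `p` has some `q < p` all of whose strict upper bounds
lie above `p`. -/
def Predetermined (α : Type*) [PartialOrder α] : Prop :=
  ∀ p : α, ¬ IsMin p → ∃ q : α, q < p ∧ ∀ r : α, q < r → p ≤ r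

/-- Branching. -/
def Branching (α : Type*) [PartialOrder α] : Prop :=
  ∀ p q : α, p < q → ∃ r : α, r < q ∧ ¬ r ≤ p ∧ ¬ p ≤ r

/-- The cap-order on elements: `p ≾ q` iff adding `q` to any family keeping `p` a cap keeps a cap. -/
def CapBelow {α : Type*} [PartialOrder α] (p q : α) : Prop :=
  ∀ F : Set α, IsCap (F ∪ {p}) → IsCap (F ∪ {q})

/-- Cap-determined: the cap-order on elements agrees with the order. -/
def CapDetermined (α : Type*) [PartialOrder α] : Prop :=
  ∀ p q : α, CapBelow p q → p ≤ q

/-- Graded: immediate predecessors have rank exactly one more. -/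
def GradedPoset (α : Type*) [PartialOrder α] : Prop :=
  ∀ p q : α, p ⋖ q → chainRank p = chainRank q + 1

/-- `Wedge p q`: `p` and `q` have a common lower bound. -/
def Wedge {α : Type*} [PartialOrder α] (p q : α) : Prop :=
  ∃ r : α, r ≤ p ∧ r ≤ q

/-- Star-below: `p ◁ q` iff there is a cap `C` with every element of the star `Cp` below `q`. -/
def StarBelow {α : Type*} [PartialOrder α] (p q : α) : Prop :=
  ∃ C : Set α, IsCap C ∧ ∀ c ∈ C, Wedge c p → c ≤ q

/-- Regular: every cap is ◁-refined by some cap. -/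
def RegularPoset (α : Type*) [PartialOrder α] : Prop :=
  ∀ C : Set α, IsCap C → ∃ D : Set α, IsCap D ∧ ∀ d ∈ D, ∃ c ∈ C, StarBelow d c

/-- Prime: for every `p` there is `F` with `F ∪ {p}` a cap but `F` not a cap. -/
def PrimePoset (α : Type*) [PartialOrder α] : Prop :=
  ∀ p : α, ∃ F : Set α, IsCap (F ∪ {p}) ∧ ¬ IsCap F

/-- Cluster: connected with respect to the common-lower-bound relation. -/
def IsCluster {α : Type*} [PartialOrder α] (C : Set α) : Prop :=
  ∀ A B : Set α, A.Nonempty → B.Nonempty → A ∪ B = C → ∃ a ∈ A, ∃ b ∈ B, Wedge a b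

/-- `D^{≤_B ≥}`: the elements sharing an upper bound in `B` with some element of `D`. -/
def SharedUpper {α : Type*} [PartialOrder α] (D B : Set α) : Set α :=
  {p : α | ∃ d ∈ D, ∃ b ∈ B, p ≤ b ∧ d ≤ b}

/-- Weakly tangled refinement. -/
def WeaklyTangledRefinement {α : Type*} [PartialOrder α] (A B : Set α) : Prop :=
  Refines A B ∧ ∀ C D : Set α, C ⊆ A → D ⊆ A → IsCluster C → IsCluster D →
    (C ∩ D).Nonempty → C ⊆ SharedUpper D B ∨ D ⊆ SharedUpper C B

/-- Weakly tangled poset: every cap has a weakly tangled refinement which is a cap. -/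
def WeaklyTangled (α : Type*) [PartialOrder α] : Prop :=
  ∀ C : Set α, IsCap C → ∃ A : Set α, IsCap A ∧ WeaklyTangledRefinement A C

/-- Injectivity of `≤` from level `n` to level `m`: every `p` in level `m` has a witness
`q` in level `n` below `p` and below no other element of level `m`. -/
def LevelInjOn (α : Type*) [PartialOrder α] (m n : ℕ) : Prop :=
  ∀ p ∈ levelSet α m, ∃ q ∈ levelSet α n,
    q ≤ p ∧ ∀ p' ∈ levelSet α m, q ≤ p' → p' = p

/-- The spectrum: the set of minimal selectors. -/
def Spectrum (α : Type*) [PartialOrder α] : Type _ :=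
  {S : Set α // IsMinSelector S}

/-- The topology on the spectrum generated by the sets `p^∈ = {S | p ∈ S}`. -/
instance {α : Type*} [PartialOrder α] : TopologicalSpace (Spectrum α) :=
  TopologicalSpace.generateFrom
    {U : Set (Spectrum α) | ∃ p : α, U = {S : Spectrum α | p ∈ S.1}}

/-- A basis of nonempty (open) sets. -/
def IsNeBasis {X : Type*} [TopologicalSpace X] (P : Set (Set X)) : Prop :=
  TopologicalSpace.IsTopologicalBasis P ∧ ∀ p ∈ P, p.Nonempty

/-- Cap-basis: a basis of nonempty open sets whose caps (under inclusion) are exactly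
the covers of the space. -/
def IsCapBasis {X : Type*} [TopologicalSpace X] (P : Set (Set X)) : Prop :=
  IsNeBasis P ∧ ∀ C : Set ↥P, (IsCap C ↔ (⋃ c ∈ C, (c : Set X)) = Set.univ)

/-- Band-basis: a basis of nonempty open sets whose bands (under inclusion) are exactly
the finite covers of the space. -/
def IsBandBasis {X : Type*} [TopologicalSpace X] (P : Set (Set X)) : Prop :=
  IsNeBasis P ∧ ∀ B : Set ↥P, (IsBand B ↔ B.Finite ∧ (⋃ b ∈ B, (b : Set X)) = Set.univ)

section

open Set TopologicalSpace

/-- If caps correspond to covers under a map to a basis of nonempty open sets of a T1 space,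
then the space is homeomorphic to the spectrum of the poset. -/
theorem nonempty_homeomorph_spectrum {X α : Type*} [TopologicalSpace X] [T1Space X]
    [PartialOrder α] (φ : α → Set X) (hφ : IsTopologicalBasis (range φ))
    (hcap : ∀ C : Set α, IsCap C ↔ ∀ x, ∃ c ∈ C, x ∈ φ c) :
    Nonempty (X ≃ₜ Spectrum α) := by
  have hopen (p : α) : IsOpen (φ p) := hφ.isOpen (mem_range_self p)
  have hsep (x y : X) (h : y ≠ x) : ∃ p, y ∈ φ p ∧ x ∉ φ p := by
    obtain ⟨_, ⟨p, rfl⟩, hy, hp⟩ := hφ.exists_subset_of_mem_open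
      (show y ∈ ({x}ᶜ : Set X) from h) isOpen_compl_singleton
    exact ⟨p, hy, fun hx => hp hx rfl⟩
  have hsel (x : X) : IsMinSelector {p | x ∈ φ p} := by
    refine ⟨fun C hC => ?_, fun T hT hTs => hT.antisymm fun p hp => ?_⟩
    · obtain ⟨c, hc, hx⟩ := (hcap C).1 hC x
      exact ⟨c, hx, hc⟩
    · obtain ⟨t, ht, ht'⟩ := hTs ({p} ∪ {q | x ∉ φ q}) <| (hcap _).2 fun y => by
        by_cases h : y = x
        · exact ⟨p, Or.inl rfl, h ▸ hp⟩
        · obtain ⟨q, hy, hx⟩ := hsep x y h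
          exact ⟨q, Or.inr hx, hy⟩
      rcases ht' with rfl | ht'
      · exact ht
      · exact absurd (hT ht) ht'
  let f : X → Spectrum α := fun x => ⟨{p | x ∈ φ p}, hsel x⟩
  have hinj : Function.Injective f := by
    intro x y hxy
    by_contra hne
    obtain ⟨p, hx, hy⟩ := hsep y x hne
    have : p ∈ (f x).1 := hx
    rw [hxy] at this
    exact hy this
  have hsurj : Function.Surjective f := by
    intro S
    have hS : ¬ IsCap (S.1)ᶜ := fun h => by
      obtain ⟨p, hp, hp'⟩ := S.2.1 _ h
      exact hp' hp
    rw [hcap] at hS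
    push Not at hS
    obtain ⟨x, hx⟩ := hS
    refine ⟨x, Subtype.ext (S.2.2 _ (fun p hp => ?_) (hsel x).1)⟩
    by_contra h
    exact hx p h hp
  have hcont : Continuous f := by
    refine continuous_generateFrom_iff.2 ?_
    rintro _ ⟨p, rfl⟩
    exact hopen p
  have hopenMap : IsOpenMap f := by
    refine hφ.isOpenMap_iff.2 ?_
    rintro _ ⟨p, rfl⟩
    refine isOpen_generateFrom_of_mem ⟨p, ?_⟩
    ext S
    constructor
    · rintro ⟨x, hx, rfl⟩
      exact hx
    · intro hS
      obtain ⟨x, rfl⟩ := hsurj S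
      exact ⟨x, hS, rfl⟩
  exact ⟨(Equiv.ofBijective f ⟨hinj, hsurj⟩).toHomeomorphOfContinuousOpen hcont hopenMap⟩

/-- A finite family of open sets of a T1 space has a finite open refinement in which each member
has a point of its own and each point `y` lies in a member contained in every set of the family
containing `y`. -/
theorem exists_finite_private_refinement {X : Type*} [TopologicalSpace X] [T1Space X]
    {A : Set (Set X)} (hA : A.Finite) (hAo : ∀ a ∈ A, IsOpen a) :
    ∃ Q : Set (Set X), Q.Finite ∧ (∀ q ∈ Q, IsOpen q) ∧
      (∀ q ∈ Q, ∃ x ∈ q, ∀ q' ∈ Q, x ∈ q' → q' = q) ∧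
      ∀ y, ∃ q ∈ Q, y ∈ q ∧ ∀ a ∈ A, y ∈ a → q ⊆ a := by
  let τ : X → Set (Set X) := fun y => {a ∈ A | y ∈ a}
  obtain ⟨F, -, hF⟩ := exists_subset_bijOn (univ : Set X) τ
  have hFfin : F.Finite := by
    refine Finite.of_finite_image ?_ hF.injOn
    refine hA.finite_subsets.subset ?_
    rintro _ ⟨y, -, rfl⟩
    exact fun a ha => ha.1
  let U : X → Set X := fun x => ⋂₀ τ x \ (F \ {x})
  have hU (x : X) : x ∈ U x := ⟨fun a ha => ha.2, fun h => h.2 rfl⟩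
  refine ⟨U '' F, hFfin.image U, ?_, ?_, fun y => ?_⟩
  · rintro _ ⟨x, -, rfl⟩
    exact ((hA.subset fun a ha => ha.1).isOpen_sInter fun a ha => hAo a ha.1).sdiff
      (hFfin.subset sdiff_subset).isClosed
  · rintro _ ⟨x, hx, rfl⟩
    refine ⟨x, hU x, ?_⟩
    rintro _ ⟨x', hx', rfl⟩ h
    by_contra hne
    refine h.2 ⟨hx, fun h' => hne ?_⟩
    rw [mem_singleton_iff.1 h']
  · obtain ⟨x, hx, hxy⟩ := hF.surjOn ⟨y, mem_univ y, rfl⟩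
    have hsub : ∀ a ∈ A, y ∈ a → U x ⊆ a := fun a ha hy z hz =>
      hz.1 a (hxy.symm ▸ (⟨ha, hy⟩ : a ∈ τ y))
    refine ⟨U x, ⟨x, hx, rfl⟩, ⟨fun a ha => ?_, fun h => h.2 ?_⟩, hsub⟩
    · rw [hxy] at ha
      exact ha.2
    · exact hF.injOn h.1 hx hxy.symm

/-- The refinement can moreover be chosen to split every nontrivial member of the family. -/
theorem exists_finite_splitting_refinement {X : Type*} [TopologicalSpace X] [T1Space X]
    {A : Set (Set X)} (hA : A.Finite) (hAo : ∀ a ∈ A, IsOpen a) :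
    ∃ Q : Set (Set X), (Q.Finite ∧ ∀ q ∈ Q, IsOpen q) ∧
      (∀ q ∈ Q, ∃ x ∈ q, ∀ q' ∈ Q, x ∈ q' → q' = q) ∧
      (∀ y, ∃ q ∈ Q, y ∈ q ∧ ∀ a ∈ A, y ∈ a → q ⊆ a) ∧
      ∀ a ∈ A, a.Nontrivial → ∃ q ∈ Q, ∃ q' ∈ Q, q ≠ q' ∧ q ⊆ a ∧ q' ⊆ a := by
  have hs : ∀ a : Set X, ∃ s : Set X, IsOpen s ∧
      (a.Nontrivial → ∃ y ∈ a, ∃ z ∈ a, y ∉ s ∧ z ∈ s) := by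
    intro a
    by_cases h : a.Nontrivial
    · obtain ⟨y, hy, z, hz, hne⟩ := h
      exact ⟨{y}ᶜ, isOpen_compl_singleton, fun _ => ⟨y, hy, z, hz, by simp, hne.symm⟩⟩
    · exact ⟨univ, isOpen_univ, fun h' => absurd h' h⟩
  choose s hso hs using hs
  obtain ⟨Q, hQ, hQo, hpriv, hcov⟩ := exists_finite_private_refinement
    (hA.union (hA.image s)) (by
      rintro a (ha | ⟨a, -, rfl⟩)
      exacts [hAo a ha, hso a])
  refine ⟨Q, ⟨hQ, hQo⟩, hpriv, fun y => ?_, fun a ha hnt => ?_⟩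
  · obtain ⟨q, hq, hy, h⟩ := hcov y
    exact ⟨q, hq, hy, fun a ha => h a (Or.inl ha)⟩
  · obtain ⟨y, hy, z, hz, hys, hzs⟩ := hs a hnt
    obtain ⟨q, hq, hyq, h⟩ := hcov y
    obtain ⟨q', hq', hzq', h'⟩ := hcov z
    refine ⟨q, hq, q', hq', ?_, h a (Or.inl ha) hy, h' a (Or.inl ha) hz⟩
    rintro rfl
    exact hys (h' _ (Or.inr ⟨a, ha, rfl⟩) hzs hyq)

/-- A sequence of finite irredundant open covers, each member of one being a union of members of
the next, which together form a basis and split every nontrivial member. -/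
structure CoverSystem (X : Type*) [TopologicalSpace X] where
  /-- The covers. -/
  lev : ℕ → Set (Set X)
  finite_lev : ∀ n, (lev n).Finite
  isOpen_of_mem : ∀ {n U}, U ∈ lev n → IsOpen U
  exists_mem : ∀ n x, ∃ U ∈ lev n, x ∈ U
  exists_private : ∀ {n U}, U ∈ lev n → ∃ x ∈ U, ∀ V ∈ lev n, x ∈ V → V = U
  exists_succ : ∀ {n U x}, U ∈ lev n → x ∈ U → ∃ V ∈ lev (n + 1), x ∈ V ∧ V ⊆ U
  exists_split : ∀ {n U}, U ∈ lev n → U.Nontrivial →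
    ∃ V ∈ lev (n + 1), ∃ W ∈ lev (n + 1), V ≠ W ∧ V ⊆ U ∧ W ⊆ U
  exists_subset : ∀ {W x}, IsOpen W → x ∈ W → ∃ n, ∃ U ∈ lev n, x ∈ U ∧ U ⊆ W

theorem nonempty_coverSystem (X : Type*) [TopologicalSpace X] [SecondCountableTopology X]
    [T1Space X] : Nonempty (CoverSystem X) := by
  obtain ⟨b, hb⟩ := ((countable_countableBasis X).insert univ).exists_eq_range
    (insert_nonempty _ _)
  have hbo (n : ℕ) : IsOpen (b n) := by
    rcases hb.symm ▸ mem_range_self n with h | h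
    · exact h ▸ isOpen_univ
    · exact isOpen_of_mem_countableBasis h
  have step (A : {A : Set (Set X) // A.Finite ∧ ∀ a ∈ A, IsOpen a}) :=
    exists_finite_splitting_refinement A.2.1 A.2.2
  choose Q hQ hpriv hcov hsplit using step
  let P : ℕ → {A : Set (Set X) // A.Finite ∧ ∀ a ∈ A, IsOpen a} := fun n =>
    Nat.rec ⟨Q ⟨∅, finite_empty, by simp⟩, hQ _⟩
      (fun n A => ⟨Q ⟨insert (b n) A.1, A.2.1.insert _, by
        rintro a (rfl | ha)
        exacts [hbo n, A.2.2 a ha]⟩, hQ _⟩) n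
  have hP (n : ℕ) : ∃ A, (P n).1 = Q A := by
    cases n with
    | zero => exact ⟨_, rfl⟩
    | succ n => exact ⟨_, rfl⟩
  refine ⟨⟨fun n => (P n).1, fun n => (P n).2.1, fun h => (P _).2.2 _ h, fun n x => ?_,
    fun {n U} h => ?_, fun {n U x} hU hx => ?_, fun {n U} hU hnt => ?_, fun {W x} hW hx => ?_⟩⟩
  · obtain ⟨A, hA⟩ := hP n
    obtain ⟨q, hq, hx, -⟩ := hcov A x
    exact ⟨q, hA ▸ hq, hx⟩
  · obtain ⟨A, hA⟩ := hP n
    simp only [hA] at h ⊢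
    exact hpriv A U h
  · obtain ⟨q, hq, hxq, h⟩ := hcov ⟨insert (b n) (P n).1, _⟩ x
    exact ⟨q, hq, hxq, h U (Or.inr hU) hx⟩
  · exact hsplit ⟨insert (b n) (P n).1, _⟩ U (Or.inr hU) hnt
  · obtain ⟨V, hV, hxV, hVW⟩ := (isBasis_countableBasis X).exists_subset_of_mem_open hx hW
    obtain ⟨n, rfl⟩ : V ∈ range b := hb ▸ Or.inr hV
    obtain ⟨q, hq, hxq, h⟩ := hcov ⟨insert (b n) (P n).1, (P n).2.1.insert _, by
        rintro a (rfl | ha)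
        exacts [hbo n, (P n).2.2 a ha]⟩ x
    exact ⟨n + 1, q, hq, hxq, (h _ (Or.inl rfl) hxV).trans hVW⟩

namespace CoverSystem

variable {X : Type*} [TopologicalSpace X] (L : CoverSystem X)

theorem exists_le {k n : ℕ} (hkn : k ≤ n) {U : Set X} {x : X} (hU : U ∈ L.lev k) (hx : x ∈ U) :
    ∃ V ∈ L.lev n, x ∈ V ∧ V ⊆ U := by
  induction n, hkn using Nat.le_induction with
  | base => exact ⟨U, hU, hx, Subset.rfl⟩
  | succ n _ ih =>
    obtain ⟨V, hV, hxV, hVU⟩ := ih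
    obtain ⟨W, hW, hxW, hWV⟩ := L.exists_succ hV hxV
    exact ⟨W, hW, hxW, hWV.trans hVU⟩

theorem exists_point {n : ℕ} {U : Set X} (hU : U ∈ L.lev n) :
    ∃ x ∈ U, (∀ V ∈ L.lev n, x ∈ V → V = U) ∧ ∀ k ≤ n, ∀ V ∈ L.lev k, x ∈ V → U ⊆ V := by
  obtain ⟨x, hx, h⟩ := L.exists_private hU
  refine ⟨x, hx, h, fun k hk V hV hxV => ?_⟩
  obtain ⟨W, hW, hxW, hWV⟩ := L.exists_le hk hV hxV
  exact h W hW hxW ▸ hWV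

theorem nonempty_of_mem {n : ℕ} {U : Set X} (hU : U ∈ L.lev n) : U.Nonempty :=
  let ⟨x, hx, _⟩ := L.exists_private hU
  ⟨x, hx⟩

theorem eq_of_subsingleton {j k : ℕ} (hjk : j ≤ k) {U V : Set X} (hU : U ∈ L.lev j)
    (hUs : U.Subsingleton) (hV : V ∈ L.lev k) {x : X} (hxU : x ∈ U) (hxV : x ∈ V) : V = U := by
  obtain ⟨W, hW, hxW, hWU⟩ := L.exists_le hjk hU hxU
  obtain rfl : W = U := hWU.antisymm fun y hy => hUs hy hxU ▸ hxW
  obtain ⟨y, hy, h⟩ := L.exists_private hW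
  exact h V hV (hUs hxU hy ▸ hxV)

/-- The poset of a cover system: members tagged with their level, where singletons are only
kept the first time they occur. -/
def Elt : Type _ :=
  {p : ℕ × Set X // p.2 ∈ L.lev p.1 ∧ ∀ m < p.1, p.2 ∈ L.lev m → p.2.Nontrivial}

variable {L}

namespace Elt

/-- The level of an element. -/
def rank (p : L.Elt) : ℕ := p.1.1

/-- The open set underlying an element. -/
def carrier (p : L.Elt) : Set X := p.1.2

theorem carrier_mem (p : L.Elt) : p.carrier ∈ L.lev p.rank := p.2.1

theorem carrier_nonempty (p : L.Elt) : p.carrier.Nonempty := L.nonempty_of_mem p.carrier_mem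

theorem nontrivial_of_mem (p : L.Elt) {m : ℕ} (hm : m < p.rank) (h : p.carrier ∈ L.lev m) :
    p.carrier.Nontrivial := p.2.2 m hm h

theorem ext {p q : L.Elt} (h : p.rank = q.rank) (h' : p.carrier = q.carrier) : p = q :=
  Subtype.ext (Prod.ext h h')

instance : PartialOrder L.Elt where
  le p q := p = q ∨ q.rank < p.rank ∧ p.carrier ⊆ q.carrier
  le_refl p := Or.inl rfl
  le_trans p q r := by
    rintro (rfl | h) (rfl | h')
    exacts [Or.inl rfl, Or.inr h', Or.inr h, Or.inr ⟨h'.1.trans h.1, h.2.trans h'.2⟩]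
  le_antisymm p q := by
    rintro (rfl | h) (h' | h')
    exacts [rfl, rfl, h'.symm, absurd h.1 h'.1.asymm]

theorem le_def {p q : L.Elt} :
    p ≤ q ↔ p = q ∨ q.rank < p.rank ∧ p.carrier ⊆ q.carrier := Iff.rfl

theorem lt_iff {p q : L.Elt} : p < q ↔ q.rank < p.rank ∧ p.carrier ⊆ q.carrier := by
  rw [lt_iff_le_and_ne, le_def]
  constructor
  · rintro ⟨rfl | h, hne⟩
    exacts [absurd rfl hne, h]
  · rintro h
    exact ⟨Or.inr h, by rintro rfl; exact h.1.false⟩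

theorem carrier_mono {p q : L.Elt} (h : p ≤ q) : p.carrier ⊆ q.carrier := by
  rcases h with rfl | h
  exacts [Subset.rfl, h.2]

theorem rank_anti {p q : L.Elt} (h : p ≤ q) : q.rank ≤ p.rank := by
  rcases h with rfl | h
  exacts [le_rfl, h.1.le]

theorem eq_of_le_of_rank_eq {p q : L.Elt} (h : p ≤ q) (h' : p.rank = q.rank) : p = q := by
  rcases h with rfl | h
  exacts [rfl, absurd h' h.1.ne']

theorem le_of_rank_le {p q : L.Elt} (hr : q.rank ≤ p.rank) (hs : p.carrier ⊆ q.carrier) :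
    p ≤ q := by
  rcases hr.lt_or_eq with h | h
  · exact Or.inr ⟨h, hs⟩
  · obtain ⟨x, hx, hp, -⟩ := L.exists_point p.carrier_mem
    exact Or.inl (ext h.symm (hp _ (h ▸ q.carrier_mem) (hs hx)).symm)

theorem nontrivial_of_lt {p q : L.Elt} (h : p < q) : q.carrier.Nontrivial := by
  by_contra hn
  rw [not_nontrivial_iff] at hn
  rw [lt_iff] at h
  obtain ⟨x, hx⟩ := p.carrier_nonempty
  have heq := L.eq_of_subsingleton h.1.le q.carrier_mem hn p.carrier_mem (h.2 hx) hx
  exact not_nontrivial_iff.2 hn (heq ▸ p.nontrivial_of_mem h.1 (heq ▸ q.carrier_mem))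

theorem exists_of_mem {n : ℕ} {U : Set X} (hU : U ∈ L.lev n) :
    ∃ p : L.Elt, p.carrier = U ∧ (p.rank = n ∨ p.rank < n ∧ U.Subsingleton) := by
  by_cases h : ∀ m < n, U ∈ L.lev m → U.Nontrivial
  · exact ⟨⟨(n, U), hU, h⟩, rfl, Or.inl rfl⟩
  · push Not at h
    obtain ⟨m, hm, hUm, hs⟩ := h
    classical
    have hex : ∃ j, U ∈ L.lev j := ⟨m, hUm⟩
    exact ⟨⟨(Nat.find hex, U), Nat.find_spec hex,
      fun j hj hUj => absurd hUj (Nat.find_min hex hj)⟩, rfl,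
      Or.inr ⟨(Nat.find_min' hex hUm).trans_lt hm, hs⟩⟩

/-- Below an element with nontrivial carrier, members of later covers are not singletons seen
before. -/
theorem exists_child (q : L.Elt) (hq : q.carrier.Nontrivial) {U : Set X}
    (hU : U ∈ L.lev (q.rank + 1)) (hUq : U ⊆ q.carrier) :
    ∃ p : L.Elt, p.carrier = U ∧ p.rank = q.rank + 1 := by
  obtain ⟨p, rfl, hp | ⟨hp, hs⟩⟩ := exists_of_mem hU
  · exact ⟨p, rfl, hp⟩
  · obtain ⟨x, hx⟩ := p.carrier_nonempty
    have := L.eq_of_subsingleton (Nat.lt_succ_iff.1 hp) p.carrier_mem hs q.carrier_mem hx (hUq hx)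
    exact absurd (this ▸ hq) (not_nontrivial_iff.2 hs)

theorem exists_between {p q : L.Elt} (h : p ≤ q) {k : ℕ} (hqk : q.rank ≤ k) (hkp : k ≤ p.rank) :
    ∃ r : L.Elt, r.rank = k ∧ p ≤ r ∧ r ≤ q := by
  obtain ⟨x, hx, -, hmin⟩ := L.exists_point p.carrier_mem
  obtain ⟨U, hU, hxU, hUq⟩ := L.exists_le hqk q.carrier_mem (carrier_mono h hx)
  have hpU := hmin k hkp U hU hxU
  obtain ⟨r, rfl, hr | ⟨hr, hs⟩⟩ := exists_of_mem hU
  · exact ⟨r, hr, le_of_rank_le (hr ▸ hkp) hpU, le_of_rank_le (hr ▸ hqk) hUq⟩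
  · have heq := L.eq_of_subsingleton (hr.le.trans hkp) r.carrier_mem hs p.carrier_mem hxU hx
    exact absurd (p.nontrivial_of_mem (hr.trans_le hkp) (heq ▸ r.carrier_mem))
      (not_nontrivial_iff.2 (heq ▸ hs))

theorem exists_ge (p : L.Elt) {k : ℕ} (hk : k ≤ p.rank) : ∃ q : L.Elt, q.rank = k ∧ p ≤ q := by
  obtain ⟨x, -, -, hmin⟩ := L.exists_point p.carrier_mem
  obtain ⟨U, hU, hxU⟩ := L.exists_mem 0 x
  let q : L.Elt := ⟨(0, U), hU, fun m hm => absurd hm m.not_lt_zero⟩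
  obtain ⟨r, hr, hpr, -⟩ := exists_between (p := p) (q := q)
    (le_of_rank_le (Nat.zero_le _) (hmin 0 (Nat.zero_le _) U hU hxU)) (Nat.zero_le k) hk
  exact ⟨r, hr, hpr⟩

theorem finite_rank_le (n : ℕ) : {p : L.Elt | p.rank ≤ n}.Finite := by
  have : (⋃ k ∈ Iic n, (fun U => (k, U)) '' L.lev k).Finite :=
    (finite_Iic n).biUnion fun k _ => (L.finite_lev k).image _
  refine (this.preimage (f := fun p : L.Elt => p.1) Subtype.val_injective.injOn).subset
    fun p hp => ?_
  exact mem_biUnion (show p.rank ∈ Iic n from hp) ⟨p.carrier, p.carrier_mem, rfl⟩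

theorem exists_chain (n : ℕ) : ∀ p : L.Elt, p.rank = n →
    ∃ c : ℕ → L.Elt, c 0 = p ∧ ∀ i < n, c i < c (i + 1) := by
  induction n with
  | zero => exact fun p _ => ⟨fun _ => p, rfl, fun i hi => absurd hi i.not_lt_zero⟩
  | succ n ih =>
    intro p hp
    obtain ⟨q, hq, hpq⟩ := p.exists_ge (k := n) (by omega)
    obtain ⟨c, hc, hlt⟩ := ih q hq
    refine ⟨fun i => Nat.casesOn i p c, rfl, fun i hi => ?_⟩
    cases i with
    | zero =>
      change p < c 0
      rw [hc]
      exact lt_of_le_of_ne hpq (by rintro rfl; omega)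
    | succ i => exact hlt i (by omega)

theorem chainRank_eq (p : L.Elt) : chainRank p = p.rank := by
  refine IsGreatest.csSup_eq ⟨exists_chain _ p rfl, ?_⟩
  rintro n ⟨c, rfl, hc⟩
  suffices ∀ i ≤ n, i + (c i).rank ≤ (c 0).rank by
    have := this n le_rfl
    omega
  intro i
  induction i with
  | zero => simp
  | succ i ih =>
    intro hi
    have h₁ := ih (by omega)
    have h₂ := (lt_iff.1 (hc i (by omega))).1
    omega

variable (L) in
theorem isOmegaPoset : IsOmegaPoset L.Elt := by
  have hfin (p : L.Elt) : (Ici p).Finite :=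
    (finite_rank_le p.rank).subset fun q hq => rank_anti hq
  refine ⟨hfin, fun n => (finite_rank_le n).subset fun p hp => ?_⟩
  have hsub : Iic p.rank ⊆ rank '' Ici p := fun k hk =>
    let ⟨q, hq, hpq⟩ := p.exists_ge hk
    ⟨q, hpq, hq⟩
  have h₁ := ncard_le_ncard hsub ((hfin p).image _)
  have h₂ := ncard_image_le (f := rank) (hfin p)
  have h₃ : (Iic p.rank).ncard = p.rank + 1 := by
    rw [← Finset.coe_Iic, ncard_coe_finset, Nat.card_Iic]
  have h₄ : (Ici p).ncard = n := hp
  exact (show p.rank ≤ n by omega)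

variable (L) in
theorem predetermined : Predetermined L.Elt := by
  intro p hp
  obtain ⟨q, hq⟩ := not_isMin_iff.1 hp
  obtain ⟨x, hx, -, hmin⟩ := L.exists_point p.carrier_mem
  obtain ⟨U, hU, hxU, hUp⟩ := L.exists_succ p.carrier_mem hx
  obtain ⟨r, rfl, hr⟩ := p.exists_child (nontrivial_of_lt hq) hU hUp
  refine ⟨r, lt_iff.2 ⟨by omega, hUp⟩, fun s hs => ?_⟩
  obtain ⟨hsr, hrs⟩ := lt_iff.1 hs
  have hsp : s.rank ≤ p.rank := by omega
  exact le_of_rank_le hsp (hmin _ hsp _ s.carrier_mem (hrs hxU))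

variable (L) in
theorem branching : Branching L.Elt := by
  intro p q hpq
  have hlt := (lt_iff.1 hpq).1
  obtain ⟨s, hs, hps, hsq⟩ := exists_between (k := p.rank - 1) hpq.le (by omega) (by omega)
  have hps' : p < s := lt_of_le_of_ne hps (by rintro rfl; omega)
  have hnt := nontrivial_of_lt hps'
  obtain ⟨U, hU, hne, hUs⟩ :
      ∃ U ∈ L.lev (s.rank + 1), U ≠ p.carrier ∧ U ⊆ s.carrier := by
    obtain ⟨V, hV, W, hW, hVW, hVs, hWs⟩ := L.exists_split s.carrier_mem hnt
    by_cases h : V = p.carrier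
    · exact ⟨W, hW, fun h' => hVW (h.trans h'.symm), hWs⟩
    · exact ⟨V, hV, h, hVs⟩
  obtain ⟨r, rfl, hr⟩ := s.exists_child hnt hU hUs
  have hrp : r.rank = p.rank := by omega
  refine ⟨r, (lt_iff.2 ⟨by omega, hUs⟩ : r < s).trans_le hsq, fun h => hne ?_, fun h => hne ?_⟩
  · rw [eq_of_le_of_rank_eq h hrp]
  · rw [eq_of_le_of_rank_eq h hrp.symm]

variable (L) in
theorem gradedPoset : GradedPoset L.Elt := by
  intro p q h
  rw [chainRank_eq, chainRank_eq]
  have hlt := (lt_iff.1 h.1).1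
  obtain ⟨r, hr, hpr, hrq⟩ := exists_between (k := q.rank + 1) h.1.le (by omega) (by omega)
  have hrq' : r < q := lt_of_le_of_ne hrq (by rintro rfl; omega)
  rcases hpr.lt_or_eq with hpr | rfl
  · exact absurd hrq' (h.2 hpr)
  · exact hr

theorem exists_mem_of_isBand {B : Set L.Elt} (hB : IsBand B) (x : X) :
    ∃ b ∈ B, x ∈ b.carrier := by
  obtain ⟨N, hN⟩ := (hB.1.image rank).bddAbove
  obtain ⟨U, hU, hxU⟩ := L.exists_mem (N + 1) x
  obtain ⟨p, rfl, hp⟩ := exists_of_mem hU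
  obtain ⟨b, hb, hpb | hbp⟩ := hB.2 p
  · exact ⟨b, hb, carrier_mono hpb hxU⟩
  · refine ⟨b, hb, ?_⟩
    have hbN : b.rank ≤ N := hN ⟨b, hb, rfl⟩
    have hpb := rank_anti hbp
    rcases hp with hp | ⟨-, hs⟩
    · omega
    · obtain ⟨y, hy⟩ := b.carrier_nonempty
      exact hs (carrier_mono hbp hy) hxU ▸ hy

variable (L) in
theorem isBand_level (N : ℕ) :
    IsBand {p : L.Elt | p.rank = N ∨ p.rank ≤ N ∧ p.carrier.Subsingleton} := by
  refine ⟨(finite_rank_le N).subset ?_, fun p => ?_⟩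
  · rintro p (h | h)
    exacts [h.le, h.1]
  rcases le_or_gt N p.rank with hN | hN
  · obtain ⟨q, hq, hpq⟩ := p.exists_ge hN
    exact ⟨q, Or.inl hq, Or.inl hpq⟩
  obtain ⟨x, hx⟩ := p.carrier_nonempty
  obtain ⟨U, hU, hxU, hUp⟩ := L.exists_le hN.le p.carrier_mem hx
  obtain ⟨q, rfl, hq | ⟨hq, hs⟩⟩ := exists_of_mem hU
  · exact ⟨q, Or.inl hq, Or.inr (le_of_rank_le (hq ▸ hN.le) hUp)⟩
  rcases le_total p.rank q.rank with h | h
  · exact ⟨q, Or.inr ⟨hq.le, hs⟩, Or.inr (le_of_rank_le h hUp)⟩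
  · have := L.eq_of_subsingleton h q.carrier_mem hs p.carrier_mem hxU hx
    exact ⟨p, Or.inr ⟨hN.le, this ▸ hs⟩, Or.inl le_rfl⟩

theorem isCap_iff [CompactSpace X] (C : Set L.Elt) :
    IsCap C ↔ ∀ x, ∃ c ∈ C, x ∈ c.carrier := by
  constructor
  · rintro ⟨B, hB, hBC⟩ x
    obtain ⟨b, hb, hx⟩ := exists_mem_of_isBand hB x
    obtain ⟨c, hc, hbc⟩ := hBC b hb
    exact ⟨c, hc, carrier_mono hbc hx⟩
  · intro hC
    obtain ⟨D, hDC, hD, hcov⟩ := isCompact_univ.elim_finite_subcover_image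
      (b := C) (c := carrier) (fun c _ => L.isOpen_of_mem c.carrier_mem) fun x _ => by
        simpa using hC x
    obtain ⟨N, hN⟩ := (hD.image rank).bddAbove
    refine ⟨_, isBand_level L N, fun p hp => ?_⟩
    obtain ⟨x, hx, -, hmin⟩ := L.exists_point p.carrier_mem
    obtain ⟨d, hd, hxd⟩ := mem_iUnion₂.1 (hcov (mem_univ x))
    have hdN : d.rank ≤ N := hN ⟨d, hd, rfl⟩
    refine ⟨d, hDC hd, ?_⟩
    rcases le_or_gt d.rank p.rank with h | h
    · exact le_of_rank_le h (hmin _ h _ d.carrier_mem hxd)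
    · rcases hp with hp | ⟨-, hs⟩
      · omega
      · have heq := L.eq_of_subsingleton h.le p.carrier_mem hs d.carrier_mem hx hxd
        exact absurd (d.nontrivial_of_mem h (heq ▸ p.carrier_mem))
          (not_nontrivial_iff.2 (heq ▸ hs))

variable (L) in
theorem isTopologicalBasis_range_carrier : IsTopologicalBasis (range (carrier (L := L))) := by
  refine isTopologicalBasis_of_isOpen_of_nhds ?_ fun x W hx hW => ?_
  · rintro _ ⟨p, rfl⟩
    exact L.isOpen_of_mem p.carrier_mem
  · obtain ⟨n, U, hU, hxU, hUW⟩ := L.exists_subset hW hx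
    obtain ⟨p, rfl, -⟩ := exists_of_mem hU
    exact ⟨_, ⟨p, rfl⟩, hxU, hUW⟩

end Elt

end CoverSystem

theorem small_of_secondCountable_t0 (X : Type*) [TopologicalSpace X] [SecondCountableTopology X]
    [T0Space X] : Small.{0} X := by
  have : Small.{0} (Set (countableBasis X)) := inferInstance
  refine small_of_injective (f := fun x => {U : countableBasis X | x ∈ U.1}) fun x y h => ?_
  refine ((isBasis_countableBasis X).inseparable_iff.2 fun U hU => ?_).eq
  exact Set.ext_iff.1 h ⟨U, hU⟩

end

/-- Every second countable compact T1 space is homeomorphic to the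
spectrum of some predetermined branching graded ω-poset. -/
theorem exists_poset_spectrum_homeo {X : Type*} [TopologicalSpace X]
    [SecondCountableTopology X] [CompactSpace X] [T1Space X] :
    ∃ (α : Type) (_ : PartialOrder α),
      IsOmegaPoset α ∧ Predetermined α ∧ Branching α ∧ GradedPoset α ∧
      Nonempty (X ≃ₜ Spectrum α) := by
  have := small_of_secondCountable_t0 X
  let e : X ≃ₜ Shrink.{0} X := Shrink.homeomorph X
  have : CompactSpace (Shrink.{0} X) := e.compactSpace
  have : T1Space (Shrink.{0} X) := e.t1Space
  have : SecondCountableTopology (Shrink.{0} X) := e.symm.secondCountableTopology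
  obtain ⟨L⟩ := nonempty_coverSystem (Shrink.{0} X)
  obtain ⟨f⟩ := nonempty_homeomorph_spectrum (CoverSystem.Elt.carrier (L := L))
    (CoverSystem.Elt.isTopologicalBasis_range_carrier L) CoverSystem.Elt.isCap_iff
  exact ⟨L.Elt, inferInstance, CoverSystem.Elt.isOmegaPoset L, CoverSystem.Elt.predetermined L,
    CoverSystem.Elt.branching L, CoverSystem.Elt.gradedPoset L, ⟨e.trans f⟩⟩
end

section
/- If P is an ω-poset then every minimal selector S of P is a filter: S is an up-set and for all p, q ∈ S there exists r ∈ S with r ≤ p and r ≤ q. -/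
theorem Refines.trans {α : Type*} [PartialOrder α] {A B C : Set α}
    (hAB : Refines A B) (hBC : Refines B C) : Refines A C := by
  intro a ha
  obtain ⟨b, hb, hab⟩ := hAB a ha
  obtain ⟨c, hc, hbc⟩ := hBC b hb
  exact ⟨c, hc, hab.trans hbc⟩

theorem IsCap.of_refines {α : Type*} [PartialOrder α] {C D : Set α}
    (hC : IsCap C) (hCD : Refines C D) : IsCap D := by
  obtain ⟨B, hB, hBC⟩ := hC
  exact ⟨B, hB, hBC.trans hCD⟩

/-- The `n`-th cone of a poset: the elements `p` such that every strictly increasing chain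
starting at `p` has at most `n` elements. -/
def orderCone (α : Type*) [PartialOrder α] : ℕ → Set α
  | 0 => ∅
  | n + 1 => {p | ∀ q, p < q → q ∈ orderCone α n}

theorem mem_orderCone_of_ncard_le {α : Type*} [PartialOrder α]
    (hfin : ∀ p : α, (Set.Ici p).Finite) (n : ℕ) (p : α) (hp : (Set.Ici p).ncard ≤ n) :
    p ∈ orderCone α n := by
  induction n generalizing p with
  | zero =>
    have hpos := (Set.ncard_pos (hfin p)).2 ⟨p, le_rfl⟩
    omega
  | succ n ih =>
    intro q hpq
    have hlt : (Set.Ici q).ncard < (Set.Ici p).ncard :=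
      Set.ncard_lt_ncard (Set.Ici_ssubset_Ici.2 hpq) (hfin p)
    exact ih q (by omega)

theorem IsOmegaPoset.finite_orderCone {α : Type*} [PartialOrder α] (h : IsOmegaPoset α)
    (n : ℕ) : (orderCone α n).Finite := by
  induction n with
  | zero => exact Set.finite_empty
  | succ n ih =>
    refine ((Set.finite_Iic ((orderCone α n).ncard + 1)).biUnion fun m _ => h.2 m).subset ?_
    intro p hp
    have hsub : Set.Ici p ⊆ insert p (orderCone α n) := by
      intro q hq
      rcases eq_or_lt_of_le (Set.mem_Ici.1 hq) with rfl | hlt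
      · exact Set.mem_insert _ _
      · exact Set.mem_insert_of_mem _ (hp q hlt)
    have hle : (Set.Ici p).ncard ≤ (orderCone α n).ncard + 1 :=
      (Set.ncard_le_ncard hsub (ih.insert p)).trans (Set.ncard_insert_le _ _)
    exact Set.mem_biUnion (Set.mem_Iic.2 hle) rfl

/-- The minimal elements of any cone after the zeroth in an ω-poset form a band. -/
theorem IsOmegaPoset.isBand_minimal_orderCone {α : Type*} [PartialOrder α]
    (h : IsOmegaPoset α) (n : ℕ) : IsBand {p | Minimal (· ∈ orderCone α (n + 1)) p} := by
  refine ⟨(h.finite_orderCone (n + 1)).subset fun p hp => hp.prop, fun p => ?_⟩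
  by_cases hp : p ∈ orderCone α (n + 1)
  · obtain ⟨q, hqp, hq⟩ := (h.finite_orderCone (n + 1)).exists_le_minimal hp
    exact ⟨q, hq, Or.inr hqp⟩
  · obtain ⟨r, hpr, hr⟩ : ∃ r, p < r ∧ r ∉ orderCone α n := by
      by_contra! hcon
      exact hp hcon
    have hfin : (Set.Ici p \ orderCone α n).Finite := (h.1 p).subset Set.sdiff_subset
    obtain ⟨q, -, hq⟩ := hfin.exists_le_maximal (a := r) ⟨hpr.le, hr⟩
    refine ⟨q, ⟨fun s hqs => ?_, fun s hs hsq => ?_⟩, Or.inl hq.prop.1⟩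
    · by_contra hcon
      exact hq.not_prop_of_gt hqs ⟨le_trans hq.prop.1 hqs.le, hcon⟩
    · rcases eq_or_lt_of_le hsq with rfl | hlt
      · exact le_rfl
      · exact absurd (hs q hlt) hq.prop.2

/-- For every finite subset `F` of an ω-poset, a single band refines all bands inside `F`. -/
theorem IsOmegaPoset.exists_isBand_refines {α : Type*} [PartialOrder α] (h : IsOmegaPoset α)
    {F : Set α} (hF : F.Finite) :
    ∃ L : Set α, IsBand L ∧ ∀ B ⊆ F, IsBand B → Refines L B := by
  obtain ⟨n, hn⟩ := (hF.image fun p => (Set.Ici p).ncard).bddAbove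
  refine ⟨_, h.isBand_minimal_orderCone n, fun B hBF hB l hl => ?_⟩
  obtain ⟨b, hb, hlb | hbl⟩ := hB.2 l
  · exact ⟨b, hb, hlb⟩
  · have hbn : (Set.Ici b).ncard ≤ n := hn (Set.mem_image_of_mem _ (hBF hb))
    exact ⟨b, hb, hl.le_of_le (mem_orderCone_of_ncard_le h.1 (n + 1) b (by omega)) hbl⟩

/-- Any two caps of an ω-poset have a common refinement which is a cap. -/
theorem IsOmegaPoset.exists_isCap_refines {α : Type*} [PartialOrder α] (h : IsOmegaPoset α)
    {C D : Set α} (hC : IsCap C) (hD : IsCap D) :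
    ∃ E : Set α, IsCap E ∧ Refines E C ∧ Refines E D := by
  obtain ⟨A, hA, hAC⟩ := hC
  obtain ⟨B, hB, hBD⟩ := hD
  obtain ⟨L, hL, hLref⟩ := h.exists_isBand_refines (hA.1.union hB.1)
  exact ⟨L, ⟨L, hL, fun l hl => ⟨l, hl, le_rfl⟩⟩,
    (hLref A Set.subset_union_left hA).trans hAC,
    (hLref B Set.subset_union_right hB).trans hBD⟩

/-- Every element of a minimal selector is its only element in some cap. -/
theorem IsMinSelector.exists_isCap {α : Type*} [PartialOrder α] {S : Set α}
    (hS : IsMinSelector S) {p : α} (hp : p ∈ S) :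
    ∃ C : Set α, IsCap C ∧ ∀ s ∈ S, s ∈ C → s = p := by
  by_contra! hcon
  have hsel : IsSelector (S \ {p}) := fun C hC => by
    obtain ⟨s, hs, hsC, hsp⟩ := hcon C hC
    exact ⟨s, ⟨hs, hsp⟩, hsC⟩
  have hpS : p ∈ S \ {p} := (hS.2 _ Set.sdiff_subset hsel).symm ▸ hp
  exact hpS.2 rfl

theorem IsMinSelector.mem_of_le {α : Type*} [PartialOrder α] {S : Set α}
    (hS : IsMinSelector S) {p q : α} (hp : p ∈ S) (hpq : p ≤ q) : q ∈ S := by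
  obtain ⟨C, hC, hCp⟩ := hS.exists_isCap hp
  have href : Refines C (insert q (C \ {p})) := fun c hc => by
    by_cases hcp : c = p
    · exact ⟨q, Set.mem_insert _ _, hcp.le.trans hpq⟩
    · exact ⟨c, Set.mem_insert_of_mem _ ⟨hc, hcp⟩, le_rfl⟩
  obtain ⟨s, hs, rfl | ⟨hsC, hsp⟩⟩ := hS.1 _ (hC.of_refines href)
  · exact hs
  · exact absurd (hCp s hs hsC) hsp

/-- In an ω-poset, every minimal selector is a filter. -/
theorem minSelector_filter {α : Type*} [PartialOrder α] (h : IsOmegaPoset α)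
    (S : Set α) (hS : IsMinSelector S) :
    (∀ p ∈ S, ∀ q : α, p ≤ q → q ∈ S) ∧
    (∀ p ∈ S, ∀ q ∈ S, ∃ r ∈ S, r ≤ p ∧ r ≤ q) := by
  refine ⟨fun p hp q hpq => hS.mem_of_le hp hpq, fun p hp q hq => ?_⟩
  obtain ⟨C, hC, hCp⟩ := hS.exists_isCap hp
  obtain ⟨D, hD, hDq⟩ := hS.exists_isCap hq
  obtain ⟨E, hE, hEC, hED⟩ := h.exists_isCap_refines hC hD
  obtain ⟨r, hr, hrE⟩ := hS.1 E hE
  obtain ⟨c, hc, hrc⟩ := hEC r hrE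
  obtain ⟨d, hd, hrd⟩ := hED r hrE
  exact ⟨r, hr, hrc.trans_eq (hCp c (hS.mem_of_le hr hrc) hc),
    hrd.trans_eq (hDq d (hS.mem_of_le hr hrd) hd)⟩
end
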